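/- Let ξ, ξ' ∈ k^× and μ, μ' ∈ k. The following are equivalent: (i) there exists a group-like element g' ∈ G(T_q) such that L(ξ,μ)^{g'} ≅ L(ξ',μ') as (T_q,T_q)-biGalois objects; (ii) L(ξ,μ) ≅ L(ξ',μ') as (T_q,T_q)-biGalois objects; (iii) μ = μ' and ξ = q^i ξ' for some integer i. In particular, every (T_q,T_q)-biGalois object A for which A^{g'} ≅ T_q for some group-like g' is already isomorphic to T_q ≅ L(1,0) as a biGalois object. -/

import Mathlib

open scoped TensorProduct

noncomputable section

/-- A left `H`-comodule algebra structure on the `k`-algebra `A`: the coaction is an algebra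
map `A → H ⊗ A` which is coassociative and counital. -/
structure LeftComodAlg (k : Type*) [Field k] (H : Type*) [Ring H] [HopfAlgebra k H]
    (A : Type*) [Ring A] [Algebra k A] where
  ρ : A →ₐ[k] H ⊗[k] A
  coassoc : ∀ a : A,
    TensorProduct.map (Coalgebra.comul (R := k)) LinearMap.id (ρ a) =
      (TensorProduct.assoc k H H A).symm (TensorProduct.map LinearMap.id ρ.toLinearMap (ρ a))
  counital : ∀ a : A,
    TensorProduct.map (Coalgebra.counit (R := k)) LinearMap.id (ρ a) = (1 : k) ⊗ₜ[k] a

namespace LeftComodAlg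

variable {k : Type*} [Field k] {H : Type*} [Ring H] [HopfAlgebra k H]
  {A : Type*} [Ring A] [Algebra k A]

/-- The coinvariants of a comodule algebra are trivial. -/
def TrivialCoinv (c : LeftComodAlg k H A) : Prop :=
  ∀ a : A, c.ρ a = (1 : H) ⊗ₜ[k] a → ∃ t : k, a = t • (1 : A)

/-- A submodule is costable if the coaction maps it into `H ⊗ I`. -/
def Costable (c : LeftComodAlg k H A) (I : Submodule k A) : Prop :=
  ∀ a ∈ I, c.ρ a ∈ LinearMap.range (LinearMap.lTensor H I.subtype)

/-- `A` is right `H`-simple: it has no nontrivial costable right ideal. -/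
def RightHSimple (c : LeftComodAlg k H A) : Prop :=
  ∀ I : Submodule k A, (∀ a ∈ I, ∀ b : A, a * b ∈ I) → c.Costable I → I = ⊥ ∨ I = ⊤

end LeftComodAlg

/-- A group-like element of a Hopf algebra. -/
def IsGrouplike (k : Type*) [Field k] {H : Type*} [Ring H] [HopfAlgebra k H] (g : H) : Prop :=
  g ≠ 0 ∧ Coalgebra.comul (R := k) g = g ⊗ₜ[k] g ∧ Coalgebra.counit (R := k) g = (1 : k)
/-- An `H`-bicomodule algebra: a `k`-algebra with a left and a right `H`-coaction, both
algebra maps, each coassociative and counital, and commuting with each other. -/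
structure BicomodAlg (k : Type*) [Field k] (H : Type*) [Ring H] [HopfAlgebra k H]
    (A : Type*) [Ring A] [Algebra k A] where
  l : A →ₐ[k] H ⊗[k] A
  r : A →ₐ[k] A ⊗[k] H
  lcoassoc : ∀ a : A,
    TensorProduct.map (Coalgebra.comul (R := k)) LinearMap.id (l a) =
      (TensorProduct.assoc k H H A).symm (TensorProduct.map LinearMap.id l.toLinearMap (l a))
  lcounital : ∀ a : A,
    TensorProduct.map (Coalgebra.counit (R := k)) LinearMap.id (l a) = (1 : k) ⊗ₜ[k] a
  rcoassoc : ∀ a : A,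
    TensorProduct.map LinearMap.id (Coalgebra.comul (R := k)) (r a) =
      (TensorProduct.assoc k A H H) (TensorProduct.map r.toLinearMap LinearMap.id (r a))
  rcounital : ∀ a : A,
    TensorProduct.map LinearMap.id (Coalgebra.counit (R := k)) (r a) = a ⊗ₜ[k] (1 : k)
  bicomod : ∀ a : A,
    TensorProduct.map l.toLinearMap LinearMap.id (r a) =
      (TensorProduct.assoc k H A H).symm (TensorProduct.map LinearMap.id r.toLinearMap (l a))

namespace BicomodAlg

variable {k : Type*} [Field k] {H : Type*} [Ring H] [HopfAlgebra k H]
  {A : Type*} [Ring A] [Algebra k A]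

/-- The canonical (left) Galois map `A ⊗ A → H ⊗ A`, `a ⊗ b ↦ a₍₋₁₎ ⊗ a₍₀₎b`. -/
def lcan (b : BicomodAlg k H A) : A ⊗[k] A →ₗ[k] H ⊗[k] A :=
  TensorProduct.map LinearMap.id (LinearMap.mul' k A) ∘ₗ
    (TensorProduct.assoc k H A A).toLinearMap ∘ₗ
      TensorProduct.map b.l.toLinearMap LinearMap.id

/-- The canonical (right) Galois map `A ⊗ A → A ⊗ H`, `a ⊗ b ↦ ab₍₀₎ ⊗ b₍₁₎`. -/
def rcan (b : BicomodAlg k H A) : A ⊗[k] A →ₗ[k] A ⊗[k] H :=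
  TensorProduct.map (LinearMap.mul' k A) LinearMap.id ∘ₗ
    (TensorProduct.assoc k A A H).symm.toLinearMap ∘ₗ
      TensorProduct.map LinearMap.id b.r.toLinearMap

/-- An `(H,H)`-biGalois object: both canonical maps are bijective, both coinvariant
subalgebras are trivial, and the algebra is nonzero. -/
structure IsBiGalois (b : BicomodAlg k H A) : Prop where
  one_ne_zero : (1 : A) ≠ 0
  lcan_bij : Function.Bijective b.lcan
  rcan_bij : Function.Bijective b.rcan
  lcoinv : ∀ a : A, b.l a = (1 : H) ⊗ₜ[k] a → ∃ t : k, a = t • (1 : A)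
  rcoinv : ∀ a : A, b.r a = a ⊗ₜ[k] (1 : H) → ∃ t : k, a = t • (1 : A)

end BicomodAlg

/-- Conjugation `h ↦ S(g) * h * g` by a group-like element `g` (with inverse `S g`). -/
def conjByGrouplike (k : Type*) [Field k] {H : Type*} [Ring H] [HopfAlgebra k H] (g : H) :
    H →ₗ[k] H :=
  LinearMap.mulLeft k (HopfAlgebra.antipode (R := k) g) ∘ₗ LinearMap.mulRight k g

/-- An isomorphism of `H`-bicomodule algebras. -/
def BicomodAlgIso {k : Type*} [Field k] {H : Type*} [Ring H] [HopfAlgebra k H]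
    {A : Type*} [Ring A] [Algebra k A] {B : Type*} [Ring B] [Algebra k B]
    (bA : BicomodAlg k H A) (bB : BicomodAlg k H B) : Prop :=
  ∃ φ : A ≃ₐ[k] B,
    (∀ a : A, bB.l (φ a) = TensorProduct.map LinearMap.id φ.toLinearMap (bA.l a)) ∧
    (∀ a : A, bB.r (φ a) = TensorProduct.map φ.toLinearMap LinearMap.id (bA.r a))

/-- An isomorphism of bicomodule algebras from `A^g` (the left coaction twisted by the
group-like element `g`) onto `B`. -/
def TwistedBicomodAlgIso {k : Type*} [Field k] {H : Type*} [Ring H] [HopfAlgebra k H]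
    {A : Type*} [Ring A] [Algebra k A] {B : Type*} [Ring B] [Algebra k B]
    (g : H) (bA : BicomodAlg k H A) (bB : BicomodAlg k H B) : Prop :=
  ∃ φ : A ≃ₐ[k] B,
    (∀ a : A, bB.l (φ a) =
      TensorProduct.map (conjByGrouplike k g) φ.toLinearMap (bA.l a)) ∧
    (∀ a : A, bB.r (φ a) = TensorProduct.map φ.toLinearMap LinearMap.id (bA.r a))
/-- A presentation of the Taft algebra `T_q`: a Hopf algebra `T` with generators `g, x`
satisfying `gⁿ = 1`, `xⁿ = 0`, `gx = q·xg`, with `g` group-like and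
`Δ(x) = x ⊗ 1 + g ⊗ x`, `ε(x) = 0`, and with basis `{xⁱgʲ : 0 ≤ i,j < n}`. -/
structure TaftPres (k : Type*) [Field k] (n : ℕ) (q : k)
    (T : Type*) [Ring T] [HopfAlgebra k T] where
  g : T
  x : T
  g_pow : g ^ n = 1
  x_pow : x ^ n = 0
  gx : g * x = q • (x * g)
  comul_g : Coalgebra.comul (R := k) g = g ⊗ₜ[k] g
  comul_x : Coalgebra.comul (R := k) x = x ⊗ₜ[k] 1 + g ⊗ₜ[k] x
  counit_g : Coalgebra.counit (R := k) g = (1 : k)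
  counit_x : Coalgebra.counit (R := k) x = (0 : k)
  li : LinearIndependent k (fun p : Fin n × Fin n => x ^ (p.1 : ℕ) * g ^ (p.2 : ℕ))
  span : ⊤ ≤ Submodule.span k (Set.range fun p : Fin n × Fin n => x ^ (p.1 : ℕ) * g ^ (p.2 : ℕ))
/-- A presentation of the `T_q`-bicomodule algebra `L(ξ,μ) = L(ξ,μ,diag(G),1)`:
it is generated by `w` and group elements `e_i` (`i ∈ ℤ/n`, `e_i = e_{(gⁱ,gⁱ)}`) with
relations `wⁿ = μ·1`, `e_i e_j = e_{i+j}`, `e_i w = qⁱ w e_i`, has basis `{e_i wʲ}`,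
left `T_q`-coaction `λ(e_i) = gⁱ ⊗ e_i`, `λ(w) = ξ·x ⊗ 1 + g ⊗ w` and right `T_q`-coaction
`ρ(e_i) = e_i ⊗ gⁱ`, `ρ(w) = w ⊗ 1 + e₁ ⊗ x` (this is the `T_q`-bicomodule algebra
corresponding to the left `T_q ⊗ T_{q⁻¹}`-comodule algebra `L(ξ,μ,diag(G),1)` under
`T_{q⁻¹} ≅ T_q^{cop}`). -/
structure LTaftPres {k : Type*} [Field k] {n : ℕ} {q : k}
    {T : Type*} [Ring T] [HopfAlgebra k T] (TP : TaftPres k n q T) (ξ μ : k)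
    {A : Type*} [Ring A] [Algebra k A] (b : BicomodAlg k T A) where
  w : A
  e : ZMod n → A
  e_zero : e 0 = 1
  e_mul : ∀ i j : ZMod n, e i * e j = e (i + j)
  ew : ∀ i : ZMod n, e i * w = q ^ i.val • (w * e i)
  w_pow : w ^ n = μ • (1 : A)
  l_e : ∀ i : ZMod n, b.l (e i) = (TP.g ^ i.val) ⊗ₜ[k] e i
  r_e : ∀ i : ZMod n, b.r (e i) = e i ⊗ₜ[k] (TP.g ^ i.val)
  l_w : b.l w = ξ • (TP.x ⊗ₜ[k] (1 : A)) + TP.g ⊗ₜ[k] w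
  r_w : b.r w = w ⊗ₜ[k] (1 : T) + e 1 ⊗ₜ[k] TP.x
  li : LinearIndependent k (fun p : ZMod n × Fin n => e p.1 * w ^ (p.2 : ℕ))
  span : ⊤ ≤ Submodule.span k (Set.range fun p : ZMod n × Fin n => e p.1 * w ^ (p.2 : ℕ))

/-- A bundled `k`-algebra carrier. -/
structure AlgCar (k : Type u) [Field k] : Type (u + 1) where
  A : Type u
  [ringA : Ring A]
  [algA : Algebra k A]

attribute [instance] AlgCar.ringA AlgCar.algA

section Helpers

open TensorProduct

/-- Permuting and rescaling a basis by nonzero scalars gives a basis. -/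
theorem linearIndependent_and_span_smul_reindex {k M ι ι' : Type*} [Field k] [AddCommGroup M]
    [Module k M] {v : ι → M} (hli : LinearIndependent k v)
    (hsp : ⊤ ≤ Submodule.span k (Set.range v)) (σ : ι' ≃ ι) (c : ι' → k) (hc : ∀ i, c i ≠ 0) :
    LinearIndependent k (fun i => c i • v (σ i)) ∧
      ⊤ ≤ Submodule.span k (Set.range fun i => c i • v (σ i)) := by
  let B := ((Module.Basis.mk hli hsp).reindex σ.symm).isUnitSMul (w := c)
    (fun i => (hc i).isUnit)
  have hB : (B : ι' → M) = fun i => c i • v (σ i) := by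
    funext i
    simp [B, Module.Basis.isUnitSMul_apply]
  rw [← hB]
  exact ⟨B.linearIndependent, B.span_eq.ge⟩

theorem pow_val_add_of_pow_eq_one {M : Type*} [Monoid M] {n : ℕ} [NeZero n] {a : M}
    (ha : a ^ n = 1) (i j : ZMod n) : a ^ (i + j).val = a ^ i.val * a ^ j.val := by
  rw [ZMod.val_add, ← pow_add, ← pow_eq_pow_mod _ ha]

section RightEval

variable {k A T : Type*} [Field k] [Ring A] [Algebra k A] [Ring T] [Algebra k T]

/-- The contraction `a ⊗ t ↦ f(t)·a`. -/
def evalRight (A : Type*) [Ring A] [Algebra k A] (f : T →ₗ[k] k) : A ⊗[k] T →ₗ[k] A :=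
  (TensorProduct.rid k A).toLinearMap ∘ₗ LinearMap.lTensor A f

/-- The contraction `t ⊗ a ↦ f(a)·t`. -/
def evalLeft (T : Type*) [Ring T] [Algebra k T] (f : A →ₗ[k] k) : T ⊗[k] A →ₗ[k] T :=
  (TensorProduct.rid k T).toLinearMap ∘ₗ LinearMap.lTensor T f

@[simp] theorem evalRight_tmul (f : T →ₗ[k] k) (a : A) (t : T) :
    evalRight A f (a ⊗ₜ[k] t) = f t • a := by simp [evalRight]

end RightEval

/-- The regular bicomodule algebra of a Hopf algebra. -/
def BicomodAlg.regular (k : Type*) [Field k] (H : Type*) [Ring H] [HopfAlgebra k H] :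
    BicomodAlg k H H where
  l := Bialgebra.comulAlgHom k H
  r := Bialgebra.comulAlgHom k H
  lcoassoc a := by
    rw [LinearEquiv.eq_symm_apply]
    exact Coalgebra.coassoc_apply a
  lcounital a := Coalgebra.rTensor_counit_comul a
  rcoassoc a := (Coalgebra.coassoc_apply a).symm
  rcounital a := Coalgebra.lTensor_counit_comul a
  bicomod a := by
    rw [LinearEquiv.eq_symm_apply]
    exact Coalgebra.coassoc_apply a

namespace TaftPres

variable {k : Type*} [Field k] {n : ℕ} {q : k} {T : Type*} [Ring T] [HopfAlgebra k T]

/-- The basis `xⁱgʲ` of the Taft algebra. -/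
def basis (TP : TaftPres k n q T) : Module.Basis (Fin n × Fin n) k T :=
  Module.Basis.mk TP.li TP.span

theorem basis_apply (TP : TaftPres k n q T) (p : Fin n × Fin n) :
    TP.basis p = TP.x ^ (p.1 : ℕ) * TP.g ^ (p.2 : ℕ) := by simp [basis]

theorem g_mul_x_pow (TP : TaftPres k n q T) (a : ℕ) :
    TP.g * TP.x ^ a = q ^ a • (TP.x ^ a * TP.g) := by
  induction a with
  | zero => simp
  | succ a ih =>
    rw [pow_succ, ← mul_assoc, ih, smul_mul_assoc, mul_assoc, TP.gx, mul_smul_comm, smul_smul,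
      ← pow_succ, mul_assoc]

theorem g_pow_mul_x_pow (TP : TaftPres k n q T) (j a : ℕ) :
    TP.g ^ j * TP.x ^ a = q ^ (j * a) • (TP.x ^ a * TP.g ^ j) := by
  induction j with
  | zero => simp
  | succ j ih =>
    rw [pow_succ, mul_assoc, g_mul_x_pow, mul_smul_comm, ← mul_assoc, ih, smul_mul_assoc,
      smul_smul, mul_assoc, ← pow_add]
    congr 2
    ring

theorem coord_x_pow_mul_g_pow [NeZero n] (TP : TaftPres k n q T) (p : Fin n × Fin n) {a : ℕ}
    (ha : a < n) (c : ℕ) :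
    TP.basis.coord p (TP.x ^ a * TP.g ^ c) =
      if p = (⟨a, ha⟩, ⟨c % n, Nat.mod_lt _ (NeZero.pos n)⟩) then 1 else 0 := by
  have : TP.x ^ a * TP.g ^ c = TP.basis (⟨a, ha⟩, ⟨c % n, Nat.mod_lt _ (NeZero.pos n)⟩) := by
    rw [basis_apply, ← pow_eq_pow_mod _ TP.g_pow]
  rw [this, Module.Basis.coord_apply, Module.Basis.repr_self, Finsupp.single_apply]
  simp [eq_comm]

theorem g_pow_val_injective [NeZero n] (TP : TaftPres k n q T) :
    Function.Injective (fun i : ZMod n => TP.g ^ i.val) := by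
  intro i j h
  have h1 := TP.li.injective
    (a₁ := (⟨0, NeZero.pos n⟩, ⟨i.val, ZMod.val_lt i⟩))
    (a₂ := (⟨0, NeZero.pos n⟩, ⟨j.val, ZMod.val_lt j⟩)) (by simpa using h)
  simp only [Prod.mk.injEq, Fin.mk.injEq, true_and] at h1
  exact ZMod.val_injective n h1

/-- The span of the `a ⊗ xⁱgʲ` with `i < d`. -/
def lowDegree (TP : TaftPres k n q T) (A : Type*) [Ring A] [Algebra k A] (d : ℕ) :
    Submodule k (A ⊗[k] T) :=
  Submodule.span k {z | ∃ (a : A) (i j : ℕ), i < d ∧ z = a ⊗ₜ[k] (TP.x ^ i * TP.g ^ j)}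

variable {A : Type*} [Ring A] [Algebra k A]

theorem tmul_mem_lowDegree (TP : TaftPres k n q T) (a : A) {i d : ℕ} (j : ℕ) (h : i < d) :
    a ⊗ₜ[k] (TP.x ^ i * TP.g ^ j) ∈ TP.lowDegree A d :=
  Submodule.subset_span ⟨a, i, j, h, rfl⟩

theorem lowDegree_mono (TP : TaftPres k n q T) {d d' : ℕ} (h : d ≤ d') :
    TP.lowDegree A d ≤ TP.lowDegree A d' := by
  apply Submodule.span_mono
  rintro _ ⟨a, i, j, hi, rfl⟩
  exact ⟨a, i, j, hi.trans_le h, rfl⟩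

theorem tmul_mul_mem_lowDegree (TP : TaftPres k n q T) (a : A) (c j : ℕ) {d : ℕ}
    {s : A ⊗[k] T} (hs : s ∈ TP.lowDegree A d) :
    a ⊗ₜ[k] (TP.x ^ c * TP.g ^ j) * s ∈ TP.lowDegree A (c + d) := by
  induction hs using Submodule.span_induction with
  | mem z hz =>
    obtain ⟨a', i, j', hi, rfl⟩ := hz
    have : TP.x ^ c * TP.g ^ j * (TP.x ^ i * TP.g ^ j') =
        q ^ (j * i) • (TP.x ^ (c + i) * TP.g ^ (j + j')) := by
      rw [mul_assoc, ← mul_assoc (TP.g ^ j), g_pow_mul_x_pow, smul_mul_assoc, mul_smul_comm,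
        pow_add, pow_add]
      simp only [mul_assoc]
    rw [Algebra.TensorProduct.tmul_mul_tmul, this, TensorProduct.tmul_smul]
    exact Submodule.smul_mem _ _ (TP.tmul_mem_lowDegree _ _ (by omega))
  | zero => simp
  | add z z' _ _ h h' => rw [mul_add]; exact add_mem h h'
  | smul c z _ h => rw [mul_smul_comm]; exact Submodule.smul_mem _ _ h

theorem evalRight_coord_eq_zero [NeZero n] (TP : TaftPres k n q T) (p : Fin n × Fin n)
    {s : A ⊗[k] T} (hs : s ∈ TP.lowDegree A (p.1 : ℕ)) :
    evalRight A (TP.basis.coord p) s = 0 := by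
  induction hs using Submodule.span_induction with
  | mem z hz =>
    obtain ⟨a, i, j, hi, rfl⟩ := hz
    rw [evalRight_tmul, coord_x_pow_mul_g_pow TP p (hi.trans p.1.2), if_neg, zero_smul]
    intro h
    rw [h] at hi
    exact lt_irrefl _ hi
  | zero => simp
  | add z z' _ _ h h' => rw [map_add, h, h', add_zero]
  | smul c z _ h => rw [map_smul, h, smul_zero]

/-- The Taft algebra with its regular coactions is `L(1,0)`. -/
def regularPres [NeZero n] (hn : 2 ≤ n) (hq : IsPrimitiveRoot q n) (TP : TaftPres k n q T)
    (b : BicomodAlg k T T) (hl : b.l = Bialgebra.comulAlgHom k T)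
    (hr : b.r = Bialgebra.comulAlgHom k T) : LTaftPres TP 1 0 b :=
  have hg : ∀ i : ℕ, Bialgebra.comulAlgHom k T (TP.g ^ i) = (TP.g ^ i) ⊗ₜ[k] (TP.g ^ i) := by
    intro i
    rw [map_pow, Bialgebra.comulAlgHom_apply, TP.comul_g, Algebra.TensorProduct.tmul_pow]
  have hv : (fun p : ZMod n × Fin n => TP.g ^ p.1.val * TP.x ^ (p.2 : ℕ)) =
      fun p => q ^ (p.1.val * (p.2 : ℕ)) •
        (fun p : Fin n × Fin n => TP.x ^ (p.1 : ℕ) * TP.g ^ (p.2 : ℕ))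
          (((Equiv.prodComm _ _).trans
            (Equiv.prodCongr (Equiv.refl _) (ZMod.finEquiv n).symm.toEquiv)) p) := by
    have hval : ∀ i : ZMod n, (((ZMod.finEquiv n).symm i : Fin n) : ℕ) = i.val := by
      obtain _ | m := n
      · exact absurd rfl (NeZero.ne 0)
      · intro i; rfl
    funext p
    simp [hval, g_pow_mul_x_pow]
  have hB := linearIndependent_and_span_smul_reindex TP.li TP.span
      ((Equiv.prodComm _ _).trans
        (Equiv.prodCongr (Equiv.refl _) (ZMod.finEquiv n).symm.toEquiv))
      (fun p : ZMod n × Fin n => q ^ (p.1.val * (p.2 : ℕ)))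
      (fun _ => pow_ne_zero _ (hq.ne_zero (NeZero.ne n)))
  { w := TP.x
    e := fun i => TP.g ^ i.val
    e_zero := by simp
    e_mul := fun i j => (pow_val_add_of_pow_eq_one TP.g_pow i j).symm
    ew := fun i => by simpa using TP.g_pow_mul_x_pow i.val 1
    w_pow := by rw [TP.x_pow, zero_smul]
    l_e := fun i => by rw [hl, hg]
    r_e := fun i => by rw [hr, hg]
    l_w := by rw [hl, Bialgebra.comulAlgHom_apply, TP.comul_x, one_smul]
    r_w := by
      have : Fact (1 < n) := ⟨hn⟩
      rw [hr, Bialgebra.comulAlgHom_apply, TP.comul_x, ZMod.val_one, pow_one]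
    li := by rw [hv]; exact hB.1
    span := by rw [hv]; exact hB.2 }

end TaftPres

namespace LTaftPres

variable {k : Type*} [Field k] {n : ℕ} {q : k} {T : Type*} [Ring T] [HopfAlgebra k T]
  {TP : TaftPres k n q T} {ξ μ : k} {A : Type*} [Ring A] [Algebra k A] {b : BicomodAlg k T A}

/-- The basis `e_i wʲ` of `L(ξ,μ)`. -/
def basis (P : LTaftPres TP ξ μ b) : Module.Basis (ZMod n × Fin n) k A :=
  Module.Basis.mk P.li P.span

theorem basis_apply (P : LTaftPres TP ξ μ b) (p : ZMod n × Fin n) :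
    P.basis p = P.e p.1 * P.w ^ (p.2 : ℕ) := by simp [basis]

theorem e_eq_basis [NeZero n] (P : LTaftPres TP ξ μ b) (i : ZMod n) :
    P.e i = P.basis (i, ⟨0, NeZero.pos n⟩) := by simp [basis_apply]

theorem e_ne_zero [NeZero n] (P : LTaftPres TP ξ μ b) (i : ZMod n) : P.e i ≠ 0 := by
  rw [e_eq_basis]
  have := P.li.ne_zero (i, (⟨0, NeZero.pos n⟩ : Fin n))
  rwa [basis_apply]

theorem one_ne_zero' [NeZero n] (P : LTaftPres TP ξ μ b) : (1 : A) ≠ 0 :=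
  P.e_zero ▸ P.e_ne_zero 0

theorem e_pow (P : LTaftPres TP ξ μ b) (i : ZMod n) (m : ℕ) : P.e i ^ m = P.e (m * i) := by
  induction m with
  | zero => simp [P.e_zero]
  | succ m ih => rw [pow_succ, ih, P.e_mul]; congr 1; push_cast; ring

theorem e_pow_card (P : LTaftPres TP ξ μ b) (i : ZMod n) : P.e i ^ n = 1 := by
  rw [e_pow, CharP.cast_eq_zero, zero_mul, P.e_zero]

theorem r_w_pow (P : LTaftPres TP ξ μ b) (d : ℕ) :
    b.r (P.w ^ d) - P.e d ⊗ₜ[k] (TP.x ^ d) ∈ TP.lowDegree A d := by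
  induction d with
  | zero => simp [P.e_zero, Algebra.TensorProduct.one_def]
  | succ d ih =>
    set s := b.r (P.w ^ d) - P.e d ⊗ₜ[k] (TP.x ^ d) with hs
    have h1 : b.r (P.w ^ d) = P.e d ⊗ₜ[k] (TP.x ^ d) + s := by rw [hs]; abel
    have h2 : b.r (P.w ^ (d + 1)) - P.e ((d + 1 : ℕ) : ZMod n) ⊗ₜ[k] (TP.x ^ (d + 1)) =
        (P.w * P.e d) ⊗ₜ[k] (TP.x ^ d * TP.g ^ 0) +
          P.w ⊗ₜ[k] (TP.x ^ 0 * TP.g ^ 0) * s + P.e 1 ⊗ₜ[k] (TP.x ^ 1 * TP.g ^ 0) * s := by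
      rw [pow_succ', map_mul, P.r_w, h1]
      simp only [add_mul, mul_add, Algebra.TensorProduct.tmul_mul_tmul, P.e_mul, one_mul,
        pow_zero, mul_one, pow_one, ← pow_succ']
      push_cast
      rw [add_comm (1 : ZMod n)]
      abel
    rw [h2]
    refine add_mem (add_mem (TP.tmul_mem_lowDegree _ _ (by omega)) ?_) ?_
    · exact TP.lowDegree_mono (by omega) (TP.tmul_mul_mem_lowDegree _ _ _ ih)
    · exact TP.lowDegree_mono (by omega) (TP.tmul_mul_mem_lowDegree _ _ _ ih)

theorem r_e_mul_w_pow (P : LTaftPres TP ξ μ b) (i : ZMod n) (d : ℕ) :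
    b.r (P.e i * P.w ^ d) -
      q ^ (i.val * d) • (P.e (i + d) ⊗ₜ[k] (TP.x ^ d * TP.g ^ i.val)) ∈ TP.lowDegree A d := by
  have h := TP.tmul_mul_mem_lowDegree (P.e i) 0 i.val (P.r_w_pow d)
  rw [mul_sub, Algebra.TensorProduct.tmul_mul_tmul, pow_zero, one_mul, TP.g_pow_mul_x_pow,
    TensorProduct.tmul_smul, P.e_mul, zero_add, ← P.r_e, ← map_mul] at h
  exact h

theorem evalRight_coord_r_of_lt [NeZero n] (P : LTaftPres TP ξ μ b) (i : ZMod n) (i₀ : Fin n)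
    {j d : Fin n} (hj : j < d) :
    evalRight A (TP.basis.coord (d, i₀)) (b.r (P.basis (i, j))) = 0 := by
  refine TP.evalRight_coord_eq_zero (d, i₀) ?_
  rw [basis_apply, ← sub_add_cancel (b.r _)
    (q ^ (i.val * (j : ℕ)) • (P.e (i + (j : ℕ)) ⊗ₜ[k] (TP.x ^ (j : ℕ) * TP.g ^ i.val)))]
  exact add_mem (TP.lowDegree_mono (Fin.le_def.1 hj.le) (P.r_e_mul_w_pow i j))
    (Submodule.smul_mem _ _ (TP.tmul_mem_lowDegree _ _ hj))

theorem evalRight_coord_r_self [NeZero n] (P : LTaftPres TP ξ μ b) (i i₀ : ZMod n)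
    (d : Fin n) :
    evalRight A (TP.basis.coord (d, ⟨i₀.val, ZMod.val_lt i₀⟩)) (b.r (P.e i * P.w ^ (d : ℕ))) =
      if i = i₀ then q ^ (i.val * (d : ℕ)) • P.e (i + (d : ℕ)) else 0 := by
  have h := TP.evalRight_coord_eq_zero (d, ⟨i₀.val, ZMod.val_lt i₀⟩) (P.r_e_mul_w_pow i d)
  rw [map_sub, sub_eq_zero] at h
  rw [h, map_smul, evalRight_tmul, TP.coord_x_pow_mul_g_pow _ d.2]
  simp only [Nat.mod_eq_of_lt (ZMod.val_lt i), Prod.mk.injEq, Fin.mk.injEq, true_and,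
    (ZMod.val_injective n).eq_iff, eq_comm (a := i₀)]
  split_ifs <;> simp

/-- A nonzero element `a` with `ρ(a) = a ⊗ h` is a multiple of some `e_m`. -/
theorem exists_eq_smul_e [NeZero n] (hq : q ≠ 0) (P : LTaftPres TP ξ μ b) {a : A} {h : T}
    (ha : a ≠ 0) (hr : b.r a = a ⊗ₜ[k] h) : ∃ (c : k) (m : ZMod n), a = c • P.e m := by
  have hne : (P.basis.repr a).support.Nonempty := by
    rw [Finsupp.support_nonempty_iff]
    simpa using ha
  obtain ⟨⟨i₀, d⟩, hp, hmax⟩ := Finset.exists_max_image _ (fun p => p.2) hne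
  rw [Finsupp.mem_support_iff] at hp
  have hsum : evalRight A (TP.basis.coord (d, ⟨i₀.val, ZMod.val_lt i₀⟩)) (b.r a) =
      P.basis.repr a (i₀, d) • q ^ (i₀.val * (d : ℕ)) • P.e (i₀ + (d : ℕ)) := by
    conv_lhs => rw [← P.basis.sum_repr a]
    simp only [map_sum, map_smul]
    rw [Finset.sum_eq_single (i₀, d), basis_apply, P.evalRight_coord_r_self, if_pos rfl]
    · rintro ⟨i, j⟩ - hij
      rcases lt_trichotomy j d with hj | rfl | hj
      · rw [P.evalRight_coord_r_of_lt _ _ hj, smul_zero]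
      · rw [basis_apply, P.evalRight_coord_r_self, if_neg, smul_zero]
        rintro rfl
        exact hij rfl
      · have : P.basis.repr a (i, j) = 0 := by
          by_contra hc
          exact absurd (hmax (i, j) (Finsupp.mem_support_iff.2 hc)) (not_le.2 hj)
        rw [this, zero_smul]
    · intro h
      exact absurd (Finset.mem_univ _) h
  rw [hr, evalRight_tmul] at hsum
  set t := TP.basis.coord (d, ⟨i₀.val, ZMod.val_lt i₀⟩) h
  have ht : t ≠ 0 := by
    intro ht
    rw [ht, zero_smul, smul_smul] at hsum
    exact (smul_ne_zero (mul_ne_zero hp (pow_ne_zero _ hq)) (P.e_ne_zero _)) hsum.symm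
  refine ⟨t⁻¹ * (P.basis.repr a (i₀, d) * q ^ (i₀.val * (d : ℕ))), i₀ + (d : ℕ), ?_⟩
  rw [mul_smul, mul_smul, ← hsum, smul_smul, inv_mul_cancel₀ ht, one_smul]

theorem exists_eq_smul_e_of_r_eq [NeZero n] (hq : q ≠ 0) (P : LTaftPres TP ξ μ b) {a : A}
    {m : ZMod n} (hr : b.r a = a ⊗ₜ[k] (TP.g ^ m.val)) : ∃ c : k, a = c • P.e m := by
  by_cases ha : a = 0
  · exact ⟨0, by rw [ha, zero_smul]⟩
  obtain ⟨c, m', rfl⟩ := P.exists_eq_smul_e hq ha hr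
  have hc : c ≠ 0 := by rintro rfl; simp at ha
  refine ⟨c, ?_⟩
  rw [map_smul, P.r_e, ← TensorProduct.smul_tmul'] at hr
  have h1 := smul_right_injective _ hc hr
  have h2 := congrArg (fun z => evalLeft T (P.basis.coord (m', ⟨0, NeZero.pos n⟩))
    (TensorProduct.comm k A T z)) h1
  simp only [TensorProduct.comm_tmul, e_eq_basis, evalLeft,
    LinearMap.comp_apply, LinearMap.lTensor_tmul, LinearEquiv.coe_coe, TensorProduct.rid_tmul,
    Module.Basis.coord_apply, Module.Basis.repr_self, Finsupp.single_eq_same, one_smul] at h2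
  rw [TP.g_pow_val_injective h2]

/-- The parameters of `L(ξ,μ)` are determined up to `ξ ↦ qⁱξ`. -/
theorem params_unique [NeZero n] (hn : 2 ≤ n) (hq : IsPrimitiveRoot q n) {ξ' μ' : k}
    (P : LTaftPres TP ξ μ b) (P' : LTaftPres TP ξ' μ' b) :
    μ = μ' ∧ ∃ i : ℕ, ξ = q ^ i * ξ' := by
  have : Fact (1 < n) := ⟨hn⟩
  have hq0 : q ≠ 0 := hq.ne_zero (NeZero.ne n)
  obtain ⟨ζ, hζ⟩ := P'.exists_eq_smul_e_of_r_eq hq0 (P.r_e 1)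
  have hζn : ζ ^ n = 1 := by
    have h1 := P.e_pow_card 1
    rw [hζ, smul_pow, P'.e_pow_card] at h1
    exact smul_left_injective k P.one_ne_zero' (by simpa using h1)
  obtain ⟨i, -, hi⟩ := hq.eq_pow_of_pow_eq_one hζn
  have hv : b.r (P.w - ζ • P'.w) = (P.w - ζ • P'.w) ⊗ₜ[k] (TP.g ^ (0 : ZMod n).val) := by
    rw [map_sub, map_smul, P.r_w, P'.r_w, hζ, smul_add, TensorProduct.sub_tmul,
      ← TensorProduct.smul_tmul', ← TensorProduct.smul_tmul']
    simp
  obtain ⟨c, hc⟩ := P'.exists_eq_smul_e_of_r_eq hq0 hv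
  rw [P'.e_zero] at hc
  have hl : b.l (P.w - ζ • P'.w) =
      ((ξ - ζ * ξ') • TP.x) ⊗ₜ[k] 1 + TP.g ⊗ₜ[k] (P.w - ζ • P'.w) := by
    rw [map_sub, map_smul, P.l_w, P'.l_w, TensorProduct.tmul_sub, TensorProduct.tmul_smul,
      ← TensorProduct.smul_tmul', sub_smul, mul_smul, smul_add]
    abel
  rw [hc, map_smul, map_one, Algebra.TensorProduct.one_def] at hl
  have h2 := congrArg (evalLeft T (P.basis.coord (0, ⟨0, NeZero.pos n⟩))) hl
  have h1 : P.basis.coord (0, ⟨0, NeZero.pos n⟩) (1 : A) = 1 := by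
    rw [← P.e_zero, e_eq_basis]; simp
  simp only [evalLeft, map_add, map_smul, LinearMap.comp_apply, LinearMap.lTensor_tmul,
    LinearEquiv.coe_coe, TensorProduct.rid_tmul, h1, one_smul, smul_eq_mul, mul_one] at h2
  have hx := congrArg (TP.basis.coord (⟨1, hn⟩, ⟨0, NeZero.pos n⟩)) h2
  have h1' := congrArg (TP.basis.coord (⟨0, NeZero.pos n⟩, ⟨0, NeZero.pos n⟩)) h2
  have e1 : (1 : T) = TP.x ^ 0 * TP.g ^ 0 := by simp
  have ex : TP.x = TP.x ^ 1 * TP.g ^ 0 := by simp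
  have eg : TP.g = TP.x ^ 0 * TP.g ^ 1 := by simp
  have k1 := fun p => TP.coord_x_pow_mul_g_pow p (NeZero.pos n) 0
  have kx := fun p => TP.coord_x_pow_mul_g_pow p (show 1 < n from hn) 0
  have kg := fun p => TP.coord_x_pow_mul_g_pow p (NeZero.pos n) 1
  rw [← e1] at k1
  rw [← ex] at kx
  rw [← eg] at kg
  simp only [map_add, map_smul, k1, kx, kg, Nat.mod_eq_of_lt (show 1 < n from hn)] at hx h1'
  simp at hx h1'
  have hw : P.w = ζ • P'.w := by
    rw [h1', zero_smul, sub_eq_zero] at hc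
    exact hc
  refine ⟨?_, i, ?_⟩
  · have := P.w_pow
    rw [hw, smul_pow, hζn, one_smul, P'.w_pow] at this
    exact (smul_left_injective k P.one_ne_zero' this).symm
  · rw [hi]
    exact sub_eq_zero.1 hx.symm

/-- Rescaling the generators by an `n`-th root of unity. -/
def rescale [NeZero n] (hn : 2 ≤ n) (P : LTaftPres TP ξ μ b) {ζ : k}
    (hζ : ζ ^ n = 1) : LTaftPres TP (ζ * ξ) μ b :=
  have hζ0 : ζ ≠ 0 := by
    rintro rfl
    simp [NeZero.ne n] at hζ
  have hv : (fun p : ZMod n × Fin n => (ζ ^ p.1.val • P.e p.1) * (ζ • P.w) ^ (p.2 : ℕ)) =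
      fun p => ζ ^ (p.1.val + (p.2 : ℕ)) •
        (fun p : ZMod n × Fin n => P.e p.1 * P.w ^ (p.2 : ℕ)) (Equiv.refl _ p) := by
    funext p
    simp only [smul_pow, smul_mul_smul_comm, pow_add, Equiv.refl_apply]
  have hB := linearIndependent_and_span_smul_reindex P.li P.span (Equiv.refl _)
      (fun p : ZMod n × Fin n => ζ ^ (p.1.val + (p.2 : ℕ))) (fun _ => pow_ne_zero _ hζ0)
  { w := ζ • P.w
    e := fun i => ζ ^ i.val • P.e i
    e_zero := by simp [P.e_zero]
    e_mul := fun i j => by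
      rw [smul_mul_smul_comm, P.e_mul, pow_val_add_of_pow_eq_one hζ]
    ew := fun i => by
      rw [smul_mul_smul_comm, P.ew, smul_mul_smul_comm, smul_smul, smul_smul]
      congr 1
      ring
    w_pow := by rw [smul_pow, hζ, one_smul, P.w_pow]
    l_e := fun i => by rw [map_smul, P.l_e, TensorProduct.tmul_smul]
    r_e := fun i => by rw [map_smul, P.r_e, TensorProduct.smul_tmul']
    l_w := by rw [map_smul, P.l_w, smul_add, smul_smul, TensorProduct.tmul_smul]
    r_w := by
      have : Fact (1 < n) := ⟨hn⟩
      rw [map_smul, P.r_w, smul_add, TensorProduct.smul_tmul', TensorProduct.smul_tmul',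
        ZMod.val_one, pow_one]
    li := by rw [hv]; exact hB.1
    span := by rw [hv]; exact hB.2 }

variable {A' : Type*} [Ring A'] [Algebra k A'] {b' : BicomodAlg k T A'}

theorem w_mul_e [NeZero n] (hq : q ≠ 0) (P : LTaftPres TP ξ μ b) (i : ZMod n) :
    P.w * P.e i = (q ^ i.val)⁻¹ • (P.e i * P.w) := by
  rw [P.ew, smul_smul, inv_mul_cancel₀ (pow_ne_zero _ hq), one_smul]

theorem w_pow_mul_e [NeZero n] (hq : q ≠ 0) (P : LTaftPres TP ξ μ b) (i : ZMod n) (j : ℕ) :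
    P.w ^ j * P.e i = (q ^ i.val)⁻¹ ^ j • (P.e i * P.w ^ j) := by
  induction j with
  | zero => simp
  | succ j ih =>
    rw [pow_succ, mul_assoc, P.w_mul_e hq, mul_smul_comm, ← mul_assoc, ih, smul_mul_assoc,
      smul_smul, mul_assoc, ← pow_succ, ← pow_succ']

theorem monomial_mul [NeZero n] (hq : q ≠ 0) (P : LTaftPres TP ξ μ b) (i i' : ZMod n)
    (j j' : ℕ) : (P.e i * P.w ^ j) * (P.e i' * P.w ^ j') =
      (q ^ i'.val)⁻¹ ^ j • (P.e (i + i') * P.w ^ (j + j')) := by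
  rw [mul_assoc, ← mul_assoc (P.w ^ j), P.w_pow_mul_e hq, smul_mul_assoc, mul_smul_comm,
    mul_assoc, ← pow_add, ← mul_assoc, P.e_mul]

theorem e_mul_w_pow_eq [NeZero n] (P : LTaftPres TP ξ μ b) (i : ZMod n) (j : ℕ) :
    P.e i * P.w ^ j = μ ^ (j / n) • P.basis (i, ⟨j % n, Nat.mod_lt _ (NeZero.pos n)⟩) := by
  rw [basis_apply]
  conv_lhs => rw [← Nat.div_add_mod j n, pow_add, pow_mul, P.w_pow, smul_pow, one_pow]
  simp

/-- Algebra maps agreeing on the generators `e_i` and `w` are equal. -/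
theorem algHom_congr (P : LTaftPres TP ξ μ b) {C : Type*} [Ring C] [Algebra k C]
    (f f' : A →ₐ[k] C) (he : ∀ i, f (P.e i) = f' (P.e i)) (hw : f P.w = f' P.w) (a : A) :
    f a = f' a := by
  refine LinearMap.congr_fun (f := f.toLinearMap) (g := f'.toLinearMap)
    (P.basis.ext fun p => ?_) a
  simp [basis_apply, he, hw]

/-- Two bicomodule algebras with presentations of the same parameters are isomorphic. -/
theorem bicomodAlgIso [NeZero n] (hq : q ≠ 0) (P : LTaftPres TP ξ μ b)
    (P' : LTaftPres TP ξ μ b') : BicomodAlgIso b b' := by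
  let φ₀ : A ≃ₗ[k] A' := P.basis.equiv P'.basis (Equiv.refl _)
  have hφ₀ : ∀ i j, φ₀ (P.e i * P.w ^ j) = P'.e i * P'.w ^ j := by
    intro i j
    rw [e_mul_w_pow_eq, e_mul_w_pow_eq, map_smul, Module.Basis.equiv_apply, Equiv.refl_apply]
  have hmul : ∀ x y, φ₀ (x * y) = φ₀ x * φ₀ y := by
    have : (LinearMap.mul k A).compr₂ φ₀.toLinearMap =
        (LinearMap.mul k A').compl₁₂ φ₀.toLinearMap φ₀.toLinearMap := by
      refine P.basis.ext fun p => P.basis.ext fun p' => ?_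
      simp only [LinearMap.compr₂_apply, LinearMap.compl₁₂_apply, LinearMap.mul_apply',
        LinearEquiv.coe_coe, basis_apply]
      rw [P.monomial_mul hq, map_smul, hφ₀, hφ₀, hφ₀, P'.monomial_mul hq]
    intro x y
    exact LinearMap.congr_fun₂ this x y
  have hone : φ₀ 1 = 1 := by
    simpa [P.e_zero, P'.e_zero] using hφ₀ 0 0
  let φ : A ≃ₐ[k] A' := AlgEquiv.ofLinearEquiv φ₀ hone hmul
  have hφe : ∀ i, φ (P.e i) = P'.e i := fun i =>
    show φ₀ (P.e i) = P'.e i by simpa using hφ₀ i 0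
  have hφw : φ P.w = P'.w :=
    show φ₀ P.w = P'.w by simpa [P.e_zero, P'.e_zero] using hφ₀ 0 1
  refine ⟨φ, ?_, ?_⟩
  · refine P.algHom_congr (b'.l.comp φ.toAlgHom)
      ((Algebra.TensorProduct.map (AlgHom.id k T) φ.toAlgHom).comp b.l) ?_ ?_
    · intro i
      simp [hφe, P.l_e, P'.l_e]
    · simp [hφw, P.l_w, P'.l_w]
  · refine P.algHom_congr (b'.r.comp φ.toAlgHom)
      ((Algebra.TensorProduct.map φ.toAlgHom (AlgHom.id k T)).comp b.r) ?_ ?_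
    · intro i
      simp [hφe, P.r_e, P'.r_e]
    · simp [hφw, hφe, P.r_w, P'.r_w]

end LTaftPres

/-- The group-likes of the Taft algebra are the powers of `g`. -/
theorem TaftPres.exists_eq_g_pow {k : Type*} [Field k] {n : ℕ} {q : k} {T : Type*} [Ring T]
    [HopfAlgebra k T] [NeZero n] (hn : 2 ≤ n) (hq : IsPrimitiveRoot q n) (TP : TaftPres k n q T)
    {h : T} (hh : IsGrouplike k h) : ∃ m : ℕ, h = TP.g ^ m := by
  obtain ⟨h0, hΔ, hε⟩ := hh
  obtain ⟨c, m, hc⟩ := (TP.regularPres hn hq (BicomodAlg.regular k T) rfl rfl).exists_eq_smul_e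
    (hq.ne_zero (NeZero.ne n)) h0 (h := h) hΔ
  have hc' : h = c • TP.g ^ m.val := hc
  have hεg : Coalgebra.counit (R := k) (TP.g ^ m.val) = (1 : k) := by
    rw [← Bialgebra.counitAlgHom_apply, map_pow, Bialgebra.counitAlgHom_apply, TP.counit_g,
      one_pow]
  rw [hc', map_smul, hεg, smul_eq_mul, mul_one] at hε
  exact ⟨m.val, by rw [hc', hε, one_smul]⟩

section Conj

variable {k : Type*} [Field k] {n : ℕ} {q : k} {T : Type*} [Ring T] [HopfAlgebra k T]

theorem conjByGrouplike_apply (g h : T) :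
    conjByGrouplike k g h = HopfAlgebra.antipode (R := k) g * (h * g) := rfl

theorem IsGrouplike.antipode_mul {g : T} (hg : IsGrouplike k g) :
    HopfAlgebra.antipode (R := k) g * g = 1 := by
  simpa [hg.2.1, hg.2.2] using HopfAlgebra.mul_antipode_rTensor_comul_apply (R := k) g

theorem IsGrouplike.mul_antipode {g : T} (hg : IsGrouplike k g) :
    g * HopfAlgebra.antipode (R := k) g = 1 := by
  simpa [hg.2.1, hg.2.2] using HopfAlgebra.mul_antipode_lTensor_comul_apply (R := k) g

theorem IsGrouplike.conjByGrouplike_injective {g : T} (hg : IsGrouplike k g) :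
    Function.Injective (conjByGrouplike k g) := by
  intro h h' e
  rw [conjByGrouplike_apply, conjByGrouplike_apply] at e
  have e' := congrArg (fun z => g * z * HopfAlgebra.antipode (R := k) g) e
  simpa [← mul_assoc, hg.mul_antipode, mul_assoc _ g, hg.mul_antipode] using e'

theorem TaftPres.conjByGrouplike_g_pow (TP : TaftPres k n q T) {m : ℕ}
    (hg : IsGrouplike k (TP.g ^ m)) (j : ℕ) :
    conjByGrouplike k (TP.g ^ m) (TP.g ^ j) = TP.g ^ j := by
  rw [conjByGrouplike_apply, ← pow_add, add_comm, pow_add, ← mul_assoc, hg.antipode_mul, one_mul]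

theorem TaftPres.conjByGrouplike_x (TP : TaftPres k n q T) {m : ℕ}
    (hg : IsGrouplike k (TP.g ^ m)) :
    q ^ m • conjByGrouplike k (TP.g ^ m) TP.x = TP.x := by
  have h := TP.g_pow_mul_x_pow m 1
  rw [pow_one, mul_one] at h
  rw [conjByGrouplike_apply, ← mul_smul_comm, ← h, ← mul_assoc, hg.antipode_mul, one_mul]

/-- Pulling back a presentation along an isomorphism twisted by `gᵐ`. -/
theorem LTaftPres.exists_of_twistedIso {TP : TaftPres k n q T} {A : Type*} [Ring A] [Algebra k A]
    {b : BicomodAlg k T A} {A' : Type*} [Ring A'] [Algebra k A'] {b' : BicomodAlg k T A'}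
    {ξ' μ' : k} (P' : LTaftPres TP ξ' μ' b') {m : ℕ} (hg : IsGrouplike k (TP.g ^ m))
    (h : TwistedBicomodAlgIso (TP.g ^ m) b b') :
    Nonempty (LTaftPres TP (q ^ m * ξ') μ' b) := by
  obtain ⟨φ, hl, hr⟩ := h
  have hinjl : Function.Injective
      (TensorProduct.map (conjByGrouplike k (TP.g ^ m)) φ.toLinearMap) :=
    TensorProduct.map_injective_of_flat_flat _ _ hg.conjByGrouplike_injective φ.injective
  have hinjr : Function.Injective
      (TensorProduct.map φ.toLinearMap (LinearMap.id : T →ₗ[k] T)) :=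
    TensorProduct.map_injective_of_flat_flat _ _ φ.injective Function.injective_id
  have hv : (fun p : ZMod n × Fin n => φ.symm (P'.e p.1) * φ.symm P'.w ^ (p.2 : ℕ)) =
      φ.symm.toLinearMap ∘ fun p : ZMod n × Fin n => P'.e p.1 * P'.w ^ (p.2 : ℕ) := by
    funext p
    simp
  refine ⟨{
    w := φ.symm P'.w
    e := fun i => φ.symm (P'.e i)
    e_zero := by rw [P'.e_zero, map_one]
    e_mul := fun i j => by rw [← map_mul, P'.e_mul]
    ew := fun i => by rw [← map_mul, P'.ew, map_smul, map_mul]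
    w_pow := by rw [← map_pow, P'.w_pow, map_smul, map_one]
    l_e := fun i => hinjl (by
      rw [← hl, φ.apply_symm_apply, P'.l_e, TensorProduct.map_tmul,
        TP.conjByGrouplike_g_pow hg, AlgEquiv.toLinearMap_apply, φ.apply_symm_apply])
    r_e := fun i => hinjr (by
      rw [← hr, φ.apply_symm_apply, P'.r_e, TensorProduct.map_tmul, LinearMap.id_apply,
        AlgEquiv.toLinearMap_apply, φ.apply_symm_apply])
    l_w := hinjl (by
      have hcg := TP.conjByGrouplike_g_pow hg 1
      rw [pow_one] at hcg
      rw [← hl, φ.apply_symm_apply, P'.l_w, map_add, map_smul, TensorProduct.map_tmul,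
        TensorProduct.map_tmul, hcg, AlgEquiv.toLinearMap_apply, AlgEquiv.toLinearMap_apply,
        φ.apply_symm_apply, map_one, mul_comm, mul_smul, TensorProduct.smul_tmul' (q ^ m),
        TP.conjByGrouplike_x hg])
    r_w := hinjr (by
      rw [← hr, φ.apply_symm_apply, P'.r_w, map_add, TensorProduct.map_tmul,
        TensorProduct.map_tmul, LinearMap.id_apply, LinearMap.id_apply,
        AlgEquiv.toLinearMap_apply, AlgEquiv.toLinearMap_apply, φ.apply_symm_apply,
        φ.apply_symm_apply])
    li := by
      rw [hv]
      exact P'.li.map' _ (LinearMap.ker_eq_bot.2 φ.symm.injective)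
    span := by
      rw [hv, Set.range_comp, Submodule.span_image, top_le_iff.1 P'.span, Submodule.map_top,
        LinearMap.range_eq_top.2 φ.symm.surjective] }⟩

theorem isGrouplike_one [Nontrivial T] : IsGrouplike k (1 : T) :=
  ⟨one_ne_zero, by rw [Bialgebra.comul_one, Algebra.TensorProduct.one_def],
    Bialgebra.counit_one⟩

theorem BicomodAlgIso.twisted_one {A : Type*} [Ring A] [Algebra k A] {b : BicomodAlg k T A}
    {A' : Type*} [Ring A'] [Algebra k A'] {b' : BicomodAlg k T A'} (h : BicomodAlgIso b b') :
    TwistedBicomodAlgIso (1 : T) b b' := by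
  have h1 : conjByGrouplike k (1 : T) = LinearMap.id := by
    ext t
    simp [conjByGrouplike_apply]
  rwa [TwistedBicomodAlgIso, h1]

end Conj

end Helpers

/-- Let `ξ, ξ' ∈ k^×` and `μ, μ' ∈ k`.  The following are equivalent:
(i) there is a group-like `g' ∈ G(T_q)` with `L(ξ,μ)^{g'} ≅ L(ξ',μ')` as biGalois objects;
(ii) `L(ξ,μ) ≅ L(ξ',μ')` as biGalois objects;
(iii) `μ = μ'` and `ξ = qⁱ ξ'` for some integer `i`.
In particular, every `(T_q,T_q)`-biGalois object `A` for which `A^{g'} ≅ T_q` for some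
group-like `g'` is already isomorphic to `T_q ≅ L(1,0)` as a biGalois object (here `T_q`
carries the biGalois structure whose two coactions are both the comultiplication). -/
theorem L_twist_iso_iff
    {k : Type*} [Field k] [IsAlgClosed k] [CharZero k]
    {n : ℕ} (hn : 2 ≤ n) {q : k} (hq : IsPrimitiveRoot q n)
    {T : Type*} [Ring T] [HopfAlgebra k T] (TP : TaftPres k n q T)
    {A : Type*} [Ring A] [Algebra k A] {A' : Type*} [Ring A'] [Algebra k A']
    (ξ ξ' μ μ' : k) (hξ : ξ ≠ 0) (hξ' : ξ' ≠ 0)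
    (b : BicomodAlg k T A) (P : LTaftPres TP ξ μ b)
    (b' : BicomodAlg k T A') (P' : LTaftPres TP ξ' μ' b') :
    -- (i) ↔ (ii) and (ii) ↔ (iii)
    (((∃ g' : T, IsGrouplike k g' ∧ TwistedBicomodAlgIso g' b b') ↔ BicomodAlgIso b b') ∧
      (BicomodAlgIso b b' ↔ (μ = μ' ∧ ∃ i : ℕ, ξ = q ^ i * ξ'))) ∧
    -- in particular: a biGalois object whose twist by a group-like is trivial is trivial
    (∀ (C : AlgCar k) (b₀ : BicomodAlg k T C.A), b₀.IsBiGalois →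
      ∀ breg : BicomodAlg k T T,
        breg.l = Bialgebra.comulAlgHom k T → breg.r = Bialgebra.comulAlgHom k T →
        (∃ g' : T, IsGrouplike k g' ∧ TwistedBicomodAlgIso g' b₀ breg) →
        BicomodAlgIso b₀ breg) := by
  have : NeZero n := ⟨by omega⟩
  have hq0 : q ≠ 0 := hq.ne_zero (NeZero.ne n)
  have : Nontrivial T := by
    have h := TP.li.ne_zero (⟨0, NeZero.pos n⟩, ⟨0, NeZero.pos n⟩)
    exact ⟨_, _, h⟩
  have h12 : BicomodAlgIso b b' → ∃ g' : T, IsGrouplike k g' ∧ TwistedBicomodAlgIso g' b b' :=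
    fun h => ⟨1, isGrouplike_one, h.twisted_one⟩
  have h23 : (∃ g' : T, IsGrouplike k g' ∧ TwistedBicomodAlgIso g' b b') →
      (μ = μ' ∧ ∃ i : ℕ, ξ = q ^ i * ξ') := by
    rintro ⟨g', hg', h⟩
    obtain ⟨m, rfl⟩ := TP.exists_eq_g_pow hn hq hg'
    obtain ⟨P₀⟩ := P'.exists_of_twistedIso hg' h
    obtain ⟨hμ, i, hi⟩ := P.params_unique hn hq P₀
    exact ⟨hμ, i + m, by rw [hi, pow_add, mul_assoc]⟩
  have hpow : ∀ i : ℕ, (q ^ i) ^ n = 1 := fun i => by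
    rw [← pow_mul, mul_comm, pow_mul, hq.pow_eq_one, one_pow]
  have h31 : (μ = μ' ∧ ∃ i : ℕ, ξ = q ^ i * ξ') → BicomodAlgIso b b' := by
    rintro ⟨rfl, i, rfl⟩
    exact P.bicomodAlgIso hq0 (P'.rescale hn (hpow i))
  refine ⟨⟨⟨fun h => h31 (h23 h), h12⟩, ⟨fun h => h23 (h12 h), h31⟩⟩, ?_⟩
  rintro C b₀ - breg hl hr ⟨g', hg', h⟩
  obtain ⟨m, rfl⟩ := TP.exists_eq_g_pow hn hq hg'
  have Q := TP.regularPres hn hq breg hl hr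
  obtain ⟨P₀⟩ := Q.exists_of_twistedIso hg' h
  exact P₀.bicomodAlgIso hq0 (Q.rescale hn (hpow m))
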